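/- arXiv:1908.00331 — 2 statements merged into one kernel-verified Lean document; each statement's English description precedes it below -/
import Mathlib

section
/- Let G be either ES_1(p,n) or ES_2(p,n). An automorphism σ of G is inner if and only if the induced automorphism of G/Z(G) is the identity, i.e. if and only if σ(g)g^{-1} ∈ Z(G) for all g ∈ G. -/
open Matrix

/-- The Heisenberg group `ES₁(p,n)`: carrier `𝔽_p^n × 𝔽_p^n × 𝔽_p`. -/
@[ext]
structure ES1 (p n : ℕ) : Type where
  u : Fin n → ZMod p
  w : Fin n → ZMod p
  z : ZMod p

namespace ES1

variable {p n : ℕ}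

instance : Mul (ES1 p n) :=
  ⟨fun x y => ⟨x.u + y.u, x.w + y.w, x.z + y.z + x.u ⬝ᵥ y.w⟩⟩

@[simp] theorem mul_u (x y : ES1 p n) : (x * y).u = x.u + y.u := rfl
@[simp] theorem mul_w (x y : ES1 p n) : (x * y).w = x.w + y.w := rfl
@[simp] theorem mul_z (x y : ES1 p n) : (x * y).z = x.z + y.z + x.u ⬝ᵥ y.w := rfl

instance : One (ES1 p n) := ⟨⟨0, 0, 0⟩⟩

@[simp] theorem one_u : (1 : ES1 p n).u = 0 := rfl
@[simp] theorem one_w : (1 : ES1 p n).w = 0 := rfl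
@[simp] theorem one_z : (1 : ES1 p n).z = 0 := rfl

instance : Inv (ES1 p n) :=
  ⟨fun x => ⟨-x.u, -x.w, -x.z + x.u ⬝ᵥ x.w⟩⟩

@[simp] theorem inv_u (x : ES1 p n) : (x⁻¹).u = -x.u := rfl
@[simp] theorem inv_w (x : ES1 p n) : (x⁻¹).w = -x.w := rfl
@[simp] theorem inv_z (x : ES1 p n) : (x⁻¹).z = -x.z + x.u ⬝ᵥ x.w := rfl

instance : Group (ES1 p n) :=
  Group.ofLeftAxioms
    (fun a b c => by
      ext <;> simp [add_dotProduct, dotProduct_add] <;> ring)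
    (fun a => by ext <;> simp)
    (fun a => by ext <;> simp [neg_dotProduct] <;> ring)

end ES1

/-- The additive embedding `ℤ/pℤ → ℤ/p²ℤ`, `a ↦ p·a`. -/
def emb (p : ℕ) (a : ZMod p) : ZMod (p ^ 2) := (p : ZMod (p ^ 2)) * (a.val : ZMod (p ^ 2))

/-- Reduction modulo `p`, `ℤ/p²ℤ → ℤ/pℤ`. -/
def red (p : ℕ) : ZMod (p ^ 2) →+* ZMod p :=
  ZMod.castHom (dvd_pow_self p (by norm_num)) (ZMod p)

section EmbLemmas

variable {p : ℕ} [NeZero p]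

theorem emb_sq_zero : (p : ZMod (p ^ 2)) * (p : ZMod (p ^ 2)) = 0 := by
  have h : ((p ^ 2 : ℕ) : ZMod (p ^ 2)) = 0 := ZMod.natCast_self _
  push_cast at h
  linear_combination h

theorem emb_mod (k : ℕ) :
    (p : ZMod (p ^ 2)) * ((k % p : ℕ) : ZMod (p ^ 2)) = (p : ZMod (p ^ 2)) * (k : ℕ) := by
  conv_rhs => rw [← Nat.div_add_mod k p]
  push_cast
  linear_combination (-((k / p : ℕ) : ZMod (p ^ 2))) * emb_sq_zero (p := p)

theorem emb_add (a b : ZMod p) : emb p (a + b) = emb p a + emb p b := by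
  unfold emb
  rw [ZMod.val_add, emb_mod]
  push_cast
  ring

theorem emb_zero : emb p (0 : ZMod p) = 0 := by
  simp [emb]

theorem emb_neg (a : ZMod p) : emb p (-a) = -emb p a := by
  have h := emb_add (p := p) (-a) a
  rw [neg_add_cancel, emb_zero] at h
  exact eq_neg_of_add_eq_zero_left h.symm

theorem emb_sub (a b : ZMod p) : emb p (a - b) = emb p a - emb p b := by
  rw [sub_eq_add_neg, emb_add, emb_neg]; ring

theorem emb_mul_emb (a b : ZMod p) : emb p a * emb p b = 0 := by
  unfold emb
  calc (p : ZMod (p ^ 2)) * (a.val : ZMod (p ^ 2)) * ((p : ZMod (p ^ 2)) * (b.val : ZMod (p ^ 2)))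
      = ((p : ZMod (p^2)) * (p : ZMod (p^2))) * ((a.val : ZMod (p ^ 2)) * (b.val : ZMod (p ^ 2))) := by ring
    _ = 0 := by rw [emb_sq_zero]; ring

theorem red_emb (a : ZMod p) : red p (emb p a) = 0 := by
  unfold emb
  rw [_root_.map_mul, map_natCast, ZMod.natCast_self]
  ring

end EmbLemmas

/-- The extra-special `p`-group of exponent `p²` and order `p^(2(m+1)+1)`
(so `n = m + 1` in the paper's notation). -/
@[ext]
structure ES2 (p m : ℕ) : Type where
  u1 : ZMod (p ^ 2)
  u : Fin m → ZMod p
  w1 : ZMod p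
  w : Fin m → ZMod p

namespace ES2

variable {p m : ℕ}

instance : Mul (ES2 p m) :=
  ⟨fun x y => ⟨x.u1 + y.u1 + emb p y.w1 * x.u1 + emb p (x.u ⬝ᵥ y.w),
    x.u + y.u, x.w1 + y.w1, x.w + y.w⟩⟩

@[simp] theorem mul_u1 (x y : ES2 p m) :
    (x * y).u1 = x.u1 + y.u1 + emb p y.w1 * x.u1 + emb p (x.u ⬝ᵥ y.w) := rfl
@[simp] theorem mul_u (x y : ES2 p m) : (x * y).u = x.u + y.u := rfl
@[simp] theorem mul_w1 (x y : ES2 p m) : (x * y).w1 = x.w1 + y.w1 := rfl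
@[simp] theorem mul_w (x y : ES2 p m) : (x * y).w = x.w + y.w := rfl

instance : One (ES2 p m) := ⟨⟨0, 0, 0, 0⟩⟩

@[simp] theorem one_u1 : (1 : ES2 p m).u1 = 0 := rfl
@[simp] theorem one_u : (1 : ES2 p m).u = 0 := rfl
@[simp] theorem one_w1 : (1 : ES2 p m).w1 = 0 := rfl
@[simp] theorem one_w : (1 : ES2 p m).w = 0 := rfl

instance : Inv (ES2 p m) :=
  ⟨fun x => ⟨(1 - emb p x.w1) * (-x.u1 + emb p (x.u ⬝ᵥ x.w)), -x.u, -x.w1, -x.w⟩⟩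

@[simp] theorem inv_u1 (x : ES2 p m) :
    (x⁻¹).u1 = (1 - emb p x.w1) * (-x.u1 + emb p (x.u ⬝ᵥ x.w)) := rfl
@[simp] theorem inv_u (x : ES2 p m) : (x⁻¹).u = -x.u := rfl
@[simp] theorem inv_w1 (x : ES2 p m) : (x⁻¹).w1 = -x.w1 := rfl
@[simp] theorem inv_w (x : ES2 p m) : (x⁻¹).w = -x.w := rfl

instance [NeZero p] : Group (ES2 p m) :=
  Group.ofLeftAxioms
    (fun a b c => by
      ext
      · simp only [mul_u1, mul_u, mul_w1, mul_w, add_dotProduct, dotProduct_add, emb_add]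
        linear_combination a.u1 * emb_mul_emb c.w1 b.w1 +
          emb_mul_emb c.w1 (a.u ⬝ᵥ b.w)
      · simp [add_assoc]
      · simp [add_assoc]
      · simp [add_assoc])
    (fun a => by
      ext <;> simp [emb_zero])
    (fun a => by
      ext
      · simp only [mul_u1, inv_u1, inv_u, inv_w1, inv_w, one_u1, neg_dotProduct, emb_neg]
        linear_combination (a.u1 - emb p (a.u ⬝ᵥ a.w)) * emb_mul_emb a.w1 a.w1
      · simp
      · simp
      · simp)

end ES2

theorem inner_key {p : ℕ} {G : Type} [Group G] (zz : ZMod p → G)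
    (hinj : Function.Injective zz) (hadd : ∀ a b, zz (a + b) = zz a * zz b)
    (B : G → G → ZMod p) (hconj : ∀ h g, h * g = zz (B h g) * (g * h))
    (hc : ∀ x, x ∈ Subgroup.center G ↔ ∃ t, x = zz t)
    (hrep : ∀ f : G → ZMod p, (∀ g g', f (g * g') = f g + f g') → ∃ h, ∀ g, f g = B h g)
    (σ : G ≃* G) :
    (∃ h : G, ∀ g : G, σ g = h * g * h⁻¹) ↔ ∀ g : G, σ g * g⁻¹ ∈ Subgroup.center G := by
  constructor
  · rintro ⟨h, hh⟩ g
    rw [hc, hh, hconj h g]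
    exact ⟨B h g, by group⟩
  · intro H
    have H' : ∀ g, ∃ t, σ g * g⁻¹ = zz t := fun g => (hc _).1 (H g)
    choose f hf using H'
    have hσ : ∀ g, σ g = zz (f g) * g := fun g => by rw [← hf]; group
    obtain ⟨h, hh⟩ := hrep f (by
      intro g g'
      apply hinj
      have hcen : zz (f g') ∈ Subgroup.center G := (hc _).2 ⟨_, rfl⟩
      have h1 := Subgroup.mem_center_iff.1 hcen g
      have h2 := map_mul σ g g'
      rw [hσ, hσ g, hσ g'] at h2
      rw [hadd]
      have h3 : zz (f g) * g * (zz (f g') * g') = zz (f g) * zz (f g') * (g * g') := by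
        rw [mul_assoc, ← mul_assoc g, h1]; group
      rw [h3] at h2
      exact mul_right_cancel h2)
    refine ⟨h, fun g => ?_⟩
    rw [hconj h g, hσ, hh]; group

theorem exists_dot {p n : ℕ} (F : (Fin n → ZMod p) → ZMod p)
    (hF : ∀ a b, F (a + b) = F a + F b) : ∃ c : Fin n → ZMod p, ∀ v, F v = c ⬝ᵥ v := by
  let F' : (Fin n → ZMod p) →ₗ[ZMod p] ZMod p := (AddMonoidHom.mk' F hF).toZModLinearMap p
  refine ⟨fun i => F' (Pi.single i 1), fun v => ?_⟩
  change F' v = _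
  rw [LinearMap.pi_apply_eq_sum_univ F' v]
  simp only [dotProduct, smul_eq_mul]
  refine Finset.sum_congr rfl fun i _ => ?_
  rw [mul_comm]
  congr 2
  ext j
  simp [Pi.single_apply, eq_comm]

theorem dot_zero {p n : ℕ} (w : Fin n → ZMod p) (h : ∀ v, v ⬝ᵥ w = 0) : w = 0 := by
  ext i
  simpa using h (Pi.single i 1)

theorem ES1_main (p m : ℕ) (σ : ES1 p (m + 1) ≃* ES1 p (m + 1)) :
      (∃ h : ES1 p (m + 1), ∀ g : ES1 p (m + 1), σ g = h * g * h⁻¹) ↔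
        ∀ g : ES1 p (m + 1), σ g * g⁻¹ ∈ Subgroup.center (ES1 p (m + 1)) := by
  refine inner_key (fun t => ⟨0, 0, t⟩) ?_ ?_ (fun h g => h.u ⬝ᵥ g.w - g.u ⬝ᵥ h.w) ?_ ?_ ?_ σ
  · intro a b h
    simpa using h
  · intro a b
    ext <;> simp
  · intro h g
    ext <;> simp <;> ring
  · intro x
    rw [Subgroup.mem_center_iff]
    constructor
    · intro h
      refine ⟨x.z, ?_⟩
      have hw : x.w = 0 := dot_zero _ fun v => by
        have := congrArg ES1.z (h ⟨v, 0, 0⟩)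
        simpa using this
      have hu : x.u = 0 := dot_zero _ fun v => by
        have := congrArg ES1.z (h ⟨0, v, 0⟩)
        simp at this
        rw [dotProduct_comm]; exact this
      ext <;> simp [hw, hu]
    · rintro ⟨t, rfl⟩ g
      ext <;> simp [add_comm]
  · intro f hf
    obtain ⟨c, hcc⟩ := exists_dot (fun v => f ⟨v, 0, 0⟩) (fun a b => by
      rw [← hf]; congr 1; ext <;> simp)
    obtain ⟨d, hd⟩ := exists_dot (fun v => f ⟨0, v, 0⟩) (fun a b => by
      rw [← hf]; congr 1; ext <;> simp)
    have hz : ∀ z, f ⟨0, 0, z⟩ = 0 := by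
      intro z
      have h1 := hf ⟨Pi.single 0 z, 0, 0⟩ ⟨0, Pi.single 0 1, 0⟩
      have h2 : (⟨Pi.single 0 z, 0, 0⟩ * ⟨0, Pi.single 0 1, 0⟩ : ES1 p (m+1)) =
        ⟨0, 0, z⟩ * (⟨0, Pi.single 0 1, 0⟩ * ⟨Pi.single 0 z, 0, 0⟩) := by
        ext <;> simp
      rw [h2, hf, hf] at h1
      linear_combination h1
    refine ⟨⟨d, -c, 0⟩, fun g => ?_⟩
    have hg : g = ⟨0, 0, g.z⟩ * (⟨0, g.w, 0⟩ * ⟨g.u, 0, 0⟩) := by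
      ext <;> simp
    have e1 := hcc g.u
    have e2 := hd g.w
    conv_lhs => rw [hg, hf, hf, hz, e1, e2]
    simp only [dotProduct_neg]
    rw [dotProduct_comm g.u c]
    ring

section
variable {p : ℕ} [Fact p.Prime]

theorem emb_inj {a : ZMod p} (h : emb p a = 0) : a = 0 := by
  unfold emb at h
  have hp := (Fact.out : p.Prime).pos
  rw [← Nat.cast_mul, ZMod.natCast_eq_zero_iff, pow_two] at h
  have := Nat.dvd_of_mul_dvd_mul_left hp h
  rw [← ZMod.natCast_zmod_val a, ZMod.natCast_eq_zero_iff]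
  exact this

theorem emb_injective : Function.Injective (emb p) := by
  intro a b h
  rw [← sub_eq_zero, ← emb_sub] at h
  exact sub_eq_zero.1 (emb_inj h)

theorem red_nat (x : ZMod (p ^ 2)) : red p x = (x.val : ZMod p) := by
  conv_lhs => rw [← ZMod.natCast_zmod_val x]
  exact map_natCast _ _

theorem emb_mul (a : ZMod p) (x : ZMod (p ^ 2)) : emb p a * x = emb p (a * red p x) := by
  rw [red_nat, emb, emb, ZMod.val_mul, emb_mod, ZMod.val_natCast]
  push_cast
  have := emb_mod (p := p) x.val
  rw [ZMod.natCast_zmod_val] at this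
  linear_combination (-(a.val : ZMod (p ^ 2))) * this

theorem exists_emb (x : ZMod (p ^ 2)) (h : red p x = 0) : ∃ a, x = emb p a := by
  rw [red_nat, ZMod.natCast_eq_zero_iff] at h
  obtain ⟨k, hk⟩ := h
  refine ⟨k, ?_⟩
  rw [emb, ZMod.val_natCast, emb_mod, ← Nat.cast_mul, ← hk, ZMod.natCast_zmod_val]

theorem exists_red (F : ZMod (p ^ 2) → ZMod p)
    (hF : ∀ a b, F (a + b) = F a + F b) : ∃ c : ZMod p, ∀ v, F v = c * red p v := by
  refine ⟨F 1, fun v => ?_⟩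
  have := map_nsmul (AddMonoidHom.mk' F hF) v.val 1
  simp only [nsmul_eq_mul, mul_one, ZMod.natCast_zmod_val, AddMonoidHom.mk'_apply] at this
  rw [this, red_nat, mul_comm]

theorem ES2_main (m : ℕ) (σ : ES2 p m ≃* ES2 p m) :
      (∃ h : ES2 p m, ∀ g : ES2 p m, σ g = h * g * h⁻¹) ↔
        ∀ g : ES2 p m, σ g * g⁻¹ ∈ Subgroup.center (ES2 p m) := by
  refine inner_key (fun t => ⟨emb p t, 0, 0, 0⟩) ?_ ?_
    (fun h g => g.w1 * red p h.u1 + h.u ⬝ᵥ g.w - h.w1 * red p g.u1 - g.u ⬝ᵥ h.w) ?_ ?_ ?_ σ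
  · intro a b h
    simp at h
    exact emb_injective h
  · intro a b
    ext <;> simp [emb_zero, emb_add]
  · intro h g
    ext
    · simp [emb_zero, emb_add, emb_mul, emb_sub]; ring_nf; simp [emb_mul_emb]
    all_goals simp [add_comm]
  · intro x
    rw [Subgroup.mem_center_iff]
    constructor
    · intro h
      have hw : x.w = 0 := dot_zero _ fun v => by
        have := congrArg ES2.u1 (h ⟨0, v, 0, 0⟩)
        simp [emb_zero] at this
        exact emb_inj this
      have hu : x.u = 0 := dot_zero _ fun v => by
        have := congrArg ES2.u1 (h ⟨0, 0, 0, v⟩)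
        simp [emb_zero] at this
        rw [dotProduct_comm]; exact emb_inj this
      have hw1 : x.w1 = 0 := by
        have := congrArg ES2.u1 (h ⟨1, 0, 0, 0⟩)
        simp [emb_zero] at this
        apply emb_inj
        linear_combination this
      have hu1 : red p x.u1 = 0 := by
        have := congrArg ES2.u1 (h ⟨0, 0, 1, 0⟩)
        simp [emb_zero, emb_mul] at this
        exact emb_inj this
      obtain ⟨a, ha⟩ := exists_emb _ hu1
      refine ⟨a, ?_⟩
      ext <;> simp [hw, hu, ha, hw1]
    · rintro ⟨t, rfl⟩ g
      ext <;> simp [add_comm, emb_zero, emb_mul_emb]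
  · intro f hf
    obtain ⟨a, ha⟩ := exists_red (fun v => f ⟨v, 0, 0, 0⟩) (fun a b => by
      rw [← hf]; congr 1; ext <;> simp [emb_zero])
    obtain ⟨b, hb⟩ := exists_dot (fun v => f ⟨0, v, 0, 0⟩) (fun a b => by
      rw [← hf]; congr 1; ext <;> simp [emb_zero])
    obtain ⟨c, hc⟩ := exists_dot (n := 1) (fun v => f ⟨0, 0, v 0, 0⟩) (fun a b => by
      rw [← hf]; congr 1; ext <;> simp [emb_zero])
    obtain ⟨d, hd⟩ := exists_dot (fun v => f ⟨0, 0, 0, v⟩) (fun a b => by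
      rw [← hf]; congr 1; ext <;> simp [emb_zero])
    refine ⟨⟨((c 0).val : ZMod (p ^ 2)), d, -a, -b⟩, fun g => ?_⟩
    have hg : g = ⟨0, 0, g.w1, 0⟩ * ⟨0, 0, 0, g.w⟩ * (⟨g.u1, 0, 0, 0⟩ * ⟨0, g.u, 0, 0⟩) := by
      ext <;> simp [emb_zero]
    have e1 := ha g.u1
    have e2 := hb g.u
    have e3 := hc (fun _ => g.w1)
    have e4 := hd g.w
    conv_lhs => rw [hg, hf, hf, hf, e1, e2, e3, e4]
    simp only [dotProduct_neg, map_natCast, ZMod.natCast_zmod_val]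
    rw [dotProduct_comm g.u b]
    simp [dotProduct]
    ring
end

theorem extraspecial_inner_iff_trivial_on_quotient (p m : ℕ) [Fact p.Prime]
    (hodd : Odd p) :
    (∀ σ : ES1 p (m + 1) ≃* ES1 p (m + 1),
      (∃ h : ES1 p (m + 1), ∀ g : ES1 p (m + 1), σ g = h * g * h⁻¹) ↔
        ∀ g : ES1 p (m + 1), σ g * g⁻¹ ∈ Subgroup.center (ES1 p (m + 1))) ∧
    (∀ σ : ES2 p m ≃* ES2 p m,
      (∃ h : ES2 p m, ∀ g : ES2 p m, σ g = h * g * h⁻¹) ↔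
        ∀ g : ES2 p m, σ g * g⁻¹ ∈ Subgroup.center (ES2 p m)) := by
  exact ⟨ES1_main p m, ES2_main m⟩
end

section
/- For G = ES_1(p,n), the automorphism group has cardinality |Aut(G)| = p^{n²+2n}(p−1)·∏_{j=1}^{n}(p^{2j}−1). -/
open Matrix

namespace ES1Aux

variable {p : ℕ} [Fact p.Prime]

/-- `f` is a symplectic tuple with multiplier `l`. -/
def Symp {V : Type} [AddCommGroup V] [Module (ZMod p) V]
    (B : V →ₗ[ZMod p] V →ₗ[ZMod p] ZMod p) (l : ZMod p) {n : ℕ} (f : Fin n → V × V) : Prop :=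
  ∀ i j, B (f i).1 (f j).1 = 0 ∧ B (f i).2 (f j).2 = 0 ∧
    B (f i).1 (f j).2 = if i = j then l else 0

section
variable {V : Type} [AddCommGroup V] [Module (ZMod p) V]
  (B : V →ₗ[ZMod p] V →ₗ[ZMod p] ZMod p)

/-- Orthogonal complement of two vectors. -/
def U (v w : V) : Submodule (ZMod p) V := LinearMap.ker (B v) ⊓ LinearMap.ker (B w)

/-- Restriction of the form. -/
def res (W : Submodule (ZMod p) V) : W →ₗ[ZMod p] W →ₗ[ZMod p] ZMod p :=
  B.compl₁₂ W.subtype W.subtype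

theorem res_apply (W : Submodule (ZMod p) V) (x y : W) : res B W x y = B x y := rfl

theorem mem_U (v w x : V) : x ∈ U B v w ↔ B v x = 0 ∧ B w x = 0 := by
  simp [U]

variable {B} {l : ZMod p}

theorem skew (hA : ∀ x, B x x = 0) (x y : V) : B x y = - B y x := by
  have := hA (x + y)
  simp [hA] at this
  exact eq_neg_of_add_eq_zero_left this

theorem proj_mem (hA : ∀ x, B x x = 0) (hl : l ≠ 0) {v w : V} (h : B v w = l) (y : V) :
    y - (l⁻¹ * B v y) • w + (l⁻¹ * B w y) • v ∈ U B v w := by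
  rw [mem_U]
  have h2 : B w v = -l := by rw [skew hA, h]
  constructor
  · simp [hA, h]; field_simp; ring
  · simp [hA, h2]; field_simp; ring

theorem card_U [Finite V] (hA : ∀ x, B x x = 0) (hl : l ≠ 0) {v w : V} (h : B v w = l) :
    Nat.card V = p ^ 2 * Nat.card (U B v w) := by
  have h2 : B w v = -l := by rw [skew hA, h]
  have e : V ≃ (ZMod p × ZMod p) × U B v w :=
    { toFun := fun y => ((B v y, B w y), ⟨_, proj_mem hA hl h y⟩)
      invFun := fun t => t.2 + (l⁻¹ * t.1.1) • w - (l⁻¹ * t.1.2) • v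
      left_inv := fun y => by simp only []; abel
      right_inv := by
        rintro ⟨⟨a, b⟩, ⟨x, hx⟩⟩
        have hx' := (mem_U B v w x).1 hx
        have e1 : B v (x + (l⁻¹ * a) • w - (l⁻¹ * b) • v) = a := by
          simp [hA, h, hx'.1]; field_simp
        have e2 : B w (x + (l⁻¹ * a) • w - (l⁻¹ * b) • v) = b := by
          simp [hA, h2, hx'.2]; field_simp
        refine Prod.ext (Prod.ext e1 e2) (Subtype.ext ?_)
        simp only [e1, e2]
        abel }
  rw [Nat.card_congr e, Nat.card_prod, Nat.card_prod, Nat.card_zmod, sq]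

theorem card_fiber [Finite V] (hl : l ≠ 0) {v w : V} (h : B v w = l) :
    Nat.card V = p * Nat.card {y // B v y = l} := by
  have e : V ≃ ZMod p × {y // B v y = l} :=
    { toFun := fun y => (B v y, ⟨y + (1 - l⁻¹ * B v y) • w, by simp [h]; field_simp; ring⟩)
      invFun := fun t => t.2 - (1 - l⁻¹ * t.1) • w
      left_inv := fun y => by simp
      right_inv := by
        rintro ⟨a, ⟨x, hx⟩⟩
        have e1 : B v (x - (1 - l⁻¹ * a) • w) = a := by
          simp [h, hx]; field_simp; ring
        refine Prod.ext e1 (Subtype.ext ?_)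
        simp only [e1]
        abel }
  rw [Nat.card_congr e, Nat.card_prod, Nat.card_zmod]

theorem symp_cons (hA : ∀ x, B x x = 0) {n : ℕ} (v w : V) (g : Fin n → V × V) :
    Symp B l (Fin.cons (v, w) g : Fin (n + 1) → V × V) ↔
      B v w = l ∧ (∀ i, (g i).1 ∈ U B v w ∧ (g i).2 ∈ U B v w) ∧ Symp B l g := by
  constructor
  · intro H
    refine ⟨by simpa using (H 0 0).2.2, fun i => ?_, fun i j => by simpa using H i.succ j.succ⟩
    simp only [mem_U]
    have h1 := H 0 i.succ
    have h2 := H i.succ 0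
    simp at h1 h2
    refine ⟨⟨h1.1, ?_⟩, ?_, h1.2.1⟩
    · rw [skew hA, h2.2.2, neg_zero]
    · rw [h1.2.2, if_neg (Fin.succ_ne_zero i).symm]
  · rintro ⟨h, hU, hg⟩ i j
    simp only [mem_U] at hU
    refine Fin.cases ?_ (fun i => ?_) i <;> refine Fin.cases ?_ (fun j => ?_) j
    · simp [hA, h]
    · simp [hU, (Fin.succ_ne_zero j).symm]
    · have a1 := skew hA (g i).1 v
      have a2 := skew hA (g i).2 w
      have a3 := skew hA (g i).1 w
      simp [hU] at a1 a2 a3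
      simp [a1, a2, a3]
    · simpa using hg i j

/-- Peel off the first hyperbolic pair. -/
noncomputable def peel (hA : ∀ x, B x x = 0) (n : ℕ) (hl : l ≠ 0) :
    {f : Fin (n + 1) → V × V // Symp B l f} ≃
    Σ v : {v : V // v ≠ 0}, Σ w : {w : V // B v.1 w = l},
      {g : Fin n → U B v.1 w.1 × U B v.1 w.1 // Symp (res B (U B v.1 w.1)) l g} where
  toFun f :=
    have hf : Symp B l (Fin.cons ((f.1 0).1, (f.1 0).2) (fun i => f.1 i.succ) :
        Fin (n + 1) → V × V) := by
      have : (Fin.cons ((f.1 0).1, (f.1 0).2) (fun i => f.1 i.succ) : Fin (n + 1) → V × V) = f.1 :=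
        Fin.cons_self_tail f.1
      rw [this]; exact f.2
    have H := (symp_cons hA _ _ _).1 hf
    ⟨⟨(f.1 0).1, by
        intro h0
        have := H.1
        rw [h0] at this
        exact hl (by simpa using this.symm)⟩, ⟨(f.1 0).2, H.1⟩,
      ⟨fun i => (⟨_, (H.2.1 i).1⟩, ⟨_, (H.2.1 i).2⟩), fun i j => by
        simpa [res_apply] using H.2.2 i j⟩⟩
  invFun t := ⟨Fin.cons (t.1.1, t.2.1.1) (fun i => ((t.2.2.1 i).1, (t.2.2.1 i).2)),
    (symp_cons hA _ _ _).2 ⟨t.2.1.2, fun i => ⟨(t.2.2.1 i).1.2, (t.2.2.1 i).2.2⟩,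
      fun i j => by simpa [res_apply] using t.2.2.2 i j⟩⟩
  left_inv f := Subtype.ext (Fin.cons_self_tail f.1)
  right_inv t := rfl

end

theorem count {l : ZMod p} (hl : l ≠ 0) (n : ℕ) :
    ∀ (V : Type) [AddCommGroup V] [Module (ZMod p) V] [Finite V]
      (B : V →ₗ[ZMod p] V →ₗ[ZMod p] ZMod p), (∀ x, B x x = 0) →
      (∀ x, (∀ y, B x y = 0) → x = 0) → Nat.card V = p ^ (2 * n) →
      Nat.card {f : Fin n → V × V // Symp B l f} =
        ∏ j ∈ Finset.range n, ((p ^ (2 * (j + 1)) - 1) * p ^ (2 * j + 1)) := by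
  have hp : 0 < p := (Fact.out : p.Prime).pos
  induction n with
  | zero =>
    intro V _ _ _ B _ _ _
    have : Unique {f : Fin 0 → V × V // Symp B l f} :=
      { default := ⟨Fin.elim0, fun i => i.elim0⟩
        uniq := fun f => Subtype.ext (Subsingleton.elim _ _) }
    simp
  | succ n ih =>
    intro V _ _ _ B hA hN hc
    rw [Nat.card_congr (peel hA n hl)]
    have key : ∀ (v : {v : V // v ≠ 0}) (w : {w : V // B v.1 w = l}),
        Nat.card {g : Fin n → U B v.1 w.1 × U B v.1 w.1 // Symp (res B (U B v.1 w.1)) l g} =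
        ∏ j ∈ Finset.range n, ((p ^ (2 * (j + 1)) - 1) * p ^ (2 * j + 1)) := by
      rintro ⟨v, hv⟩ ⟨w, hw⟩
      apply ih
      · intro x; exact hA x
      · rintro ⟨x, hx⟩ h
        have hx' := (mem_U B v w x).1 hx
        apply Subtype.ext
        apply hN
        intro y
        have := h ⟨_, proj_mem hA hl hw y⟩
        have a1 := skew hA x v
        have a2 := skew hA x w
        rw [hx'.1] at a1
        rw [hx'.2] at a2
        simpa [res_apply, a1, a2] using this
      · have := card_U hA hl hw
        rw [hc, mul_add, pow_add, mul_comm] at this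
        exact (Nat.eq_of_mul_eq_mul_left (pow_pos hp 2) this).symm
    have key2 : ∀ v : {v : V // v ≠ 0}, Nat.card {w : V // B v.1 w = l} = p ^ (2 * n + 1) := by
      rintro ⟨v, hv⟩
      obtain ⟨y, hy⟩ : ∃ y, B v y ≠ 0 := by
        by_contra! h
        exact hv (hN v h)
      have := card_fiber hl (v := v) (w := (l * (B v y)⁻¹) • y) (B := B) (l := l)
        (by simp; field_simp)
      rw [hc, show 2 * (n + 1) = 1 + (2 * n + 1) by ring, pow_add, pow_one] at this
      exact (Nat.eq_of_mul_eq_mul_left hp this).symm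
    have key3 : Nat.card {v : V // v ≠ 0} = p ^ (2 * (n + 1)) - 1 := by
      classical
      have := Fintype.ofFinite V
      rw [← hc, Nat.card_eq_fintype_card, Nat.card_eq_fintype_card]
      exact Fintype.card_subtype_compl (fun v : V => v = 0) |>.trans (by simp)
    have := Fintype.ofFinite {v : V // v ≠ 0}
    have : ∀ v : {v : V // v ≠ 0}, Fintype {w : V // B v.1 w = l} := fun v => Fintype.ofFinite _
    rw [Nat.card_sigma]
    simp_rw [Nat.card_sigma, key]
    simp only [Finset.sum_const, Finset.card_univ, ← Nat.card_eq_fintype_card, key2, key3,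
      smul_eq_mul]
    rw [Finset.prod_range_succ]
    ring

/-- The symplectic space. -/
abbrev VV (p n : ℕ) := (Fin n → ZMod p) × (Fin n → ZMod p)

/-- The symplectic form. -/
def om (p n : ℕ) : VV p n →ₗ[ZMod p] VV p n →ₗ[ZMod p] ZMod p :=
  LinearMap.mk₂ (ZMod p) (fun x y => x.1 ⬝ᵥ y.2 - y.1 ⬝ᵥ x.2)
    (fun x y z => by simp [add_dotProduct, dotProduct_add]; ring)
    (fun c x y => by simp [mul_sub])
    (fun x y z => by simp [add_dotProduct, dotProduct_add]; ring)
    (fun c x y => by simp [mul_sub])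

theorem om_apply {n : ℕ} (x y : VV p n) : om p n x y = x.1 ⬝ᵥ y.2 - y.1 ⬝ᵥ x.2 := rfl

theorem om_alt {n : ℕ} (x : VV p n) : om p n x x = 0 := by simp [om_apply]

theorem om_nondeg {n : ℕ} (x : VV p n) (h : ∀ y, om p n x y = 0) : x = 0 := by
  refine Prod.ext (funext fun i => ?_) (funext fun i => ?_)
  · simpa [om_apply] using h (0, Pi.single i 1)
  · simpa [om_apply] using h (Pi.single i 1, 0)

/-- The standard basis. -/
noncomputable def bas (p n : ℕ) [Fact p.Prime] : Module.Basis (Fin n ⊕ Fin n) (ZMod p) (VV p n) :=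
  (Pi.basisFun (ZMod p) (Fin n)).prod (Pi.basisFun (ZMod p) (Fin n))

theorem symp_iff {n : ℕ} (l : ZMod p) (T : VV p n →ₗ[ZMod p] VV p n) :
    (∀ x y, om p n (T x) (T y) = l * om p n x y) ↔
      Symp (om p n) l (fun i => (T (bas p n (Sum.inl i)), T (bas p n (Sum.inr i)))) := by
  constructor
  · intro h i j
    simp only [h]
    refine ⟨?_, ?_, ?_⟩
    · simp [om_apply, bas]
    · simp [om_apply, bas]
    · simp [om_apply, bas, Pi.single_apply, eq_comm]
  · intro h
    have : (om p n).compl₁₂ T T = l • om p n := by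
      refine (bas p n).ext fun i => (bas p n).ext fun j => ?_
      rcases i with i | i <;> rcases j with j | j
      · have := (h i j).1
        simp only [LinearMap.compl₁₂_apply, this]
        simp [om_apply, bas]
      · have := (h i j).2.2
        simp only [LinearMap.compl₁₂_apply, this]
        simp [om_apply, bas, Pi.single_apply, eq_comm]
      · have := (h j i).2.2
        simp only [LinearMap.compl₁₂_apply]
        rw [skew om_alt, this]
        simp [om_apply, bas, Pi.single_apply, eq_comm]
      · have := (h i j).2.1
        simp only [LinearMap.compl₁₂_apply, this]
        simp [om_apply, bas]
    intro x y
    simpa using LinearMap.congr_fun (LinearMap.congr_fun this x) y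

theorem card_VV (n : ℕ) : Nat.card (VV p n) = p ^ (2 * n) := by
  simp [two_mul, pow_add]

theorem card_sim {n : ℕ} {l : ZMod p} (hl : l ≠ 0) :
    Nat.card {T : VV p n →ₗ[ZMod p] VV p n // ∀ x y, om p n (T x) (T y) = l * om p n x y} =
      ∏ j ∈ Finset.range n, ((p ^ (2 * (j + 1)) - 1) * p ^ (2 * j + 1)) := by
  rw [← count hl n (VV p n) (om p n) om_alt om_nondeg (card_VV n)]
  let e : (VV p n →ₗ[ZMod p] VV p n) ≃ (Fin n → VV p n × VV p n) :=
    (((bas p n).constr (ZMod p)).symm.toEquiv.trans (Equiv.sumArrowEquivProdArrow _ _ _)).trans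
      (Equiv.arrowProdEquivProdArrow (Fin n) (fun _ => VV p n) (fun _ => VV p n)).symm
  refine Nat.card_congr (e.subtypeEquiv fun T => ?_)
  rw [symp_iff]
  rfl

/-- Symmetric coordinates. -/
def mk {n : ℕ} (x : VV p n) (s : ZMod p) : ES1 p n := ⟨x.1, x.2, s + 2⁻¹ * (x.1 ⬝ᵥ x.2)⟩

/-- Vector part. -/
def vec {n : ℕ} (g : ES1 p n) : VV p n := (g.u, g.w)

/-- Symmetric central coordinate. -/
def cen {n : ℕ} (g : ES1 p n) : ZMod p := g.z - 2⁻¹ * (g.u ⬝ᵥ g.w)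

@[simp] theorem mk_vec_cen {n : ℕ} (g : ES1 p n) : mk (vec g) (cen g) = g := by
  ext <;> simp [mk, vec, cen]
@[simp] theorem vec_mk {n : ℕ} (x : VV p n) (s : ZMod p) : vec (mk x s) = x := rfl
@[simp] theorem cen_mk {n : ℕ} (x : VV p n) (s : ZMod p) : cen (mk x s) = s := by
  simp [mk, cen]

theorem mk_inj {n : ℕ} {x y : VV p n} {s t : ZMod p} (h : mk x s = mk y t) : x = y ∧ s = t :=
  ⟨by simpa using congrArg vec h, by simpa using congrArg cen h⟩

theorem two_ne (hodd : Odd p) : (2 : ZMod p) ≠ 0 := by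
  intro h
  have h2 : ((2 : ℕ) : ZMod p) = 0 := by exact_mod_cast h
  rw [ZMod.natCast_eq_zero_iff] at h2
  have := (Nat.prime_dvd_prime_iff_eq Fact.out Nat.prime_two).1 h2
  subst this
  exact absurd hodd (by decide)

theorem mk_mul (hodd : Odd p) {n : ℕ} (x y : VV p n) (s t : ZMod p) :
    mk x s * mk y t = mk (x + y) (s + t + 2⁻¹ * om p n x y) := by
  have := two_ne hodd
  ext
  · simp [mk]
  · simp [mk]
  · simp [mk, om_apply, add_dotProduct, dotProduct_add]
    field_simp
    ring

/-- The data describing automorphisms. -/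
abbrev Data (p n : ℕ) [Fact p.Prime] :=
  Σ l : (ZMod p)ˣ, {T : VV p n →ₗ[ZMod p] VV p n //
      ∀ x y, om p n (T x) (T y) = (l : ZMod p) * om p n x y} × (VV p n →ₗ[ZMod p] ZMod p)

/-- The homomorphism attached to data. -/
def homOf (hodd : Odd p) {n : ℕ} (d : Data p n) : ES1 p n →* ES1 p n :=
  MonoidHom.mk' (fun g => mk (d.2.1.1 (vec g)) (d.2.2 (vec g) + d.1 * cen g)) (by
    intro g h
    rw [mk_mul hodd, ← mk_vec_cen g, ← mk_vec_cen h, mk_mul hodd]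
    simp only [vec_mk, cen_mk, map_add, d.2.1.2]
    congr 1
    ring)

theorem homOf_mk (hodd : Odd p) {n : ℕ} (d : Data p n) (x : VV p n) (s : ZMod p) :
    homOf hodd d (mk x s) = mk (d.2.1.1 x) (d.2.2 x + d.1 * s) := by
  simp [homOf]

instance finES1 {n : ℕ} : Finite (ES1 p n) :=
  Finite.of_injective (fun g => (g.u, g.w, g.z)) (by
    intro g h H
    simp at H
    ext1 <;> simp [H])

theorem homOf_bij (hodd : Odd p) {n : ℕ} (d : Data p n) : Function.Bijective (homOf hodd d) := by
  apply Finite.injective_iff_bijective.1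
  rw [injective_iff_map_eq_one]
  intro g hg
  rw [← mk_vec_cen g, homOf_mk] at hg
  have h1 : (1 : ES1 p n) = mk 0 0 := by ext <;> simp [mk]
  rw [h1] at hg
  obtain ⟨a, b⟩ := mk_inj hg
  have hv : vec g = 0 := by
    apply om_nondeg
    intro y
    have := d.2.1.2 (vec g) y
    rw [a] at this
    simpa using this.symm
  have hc : cen g = 0 := by
    rw [hv] at b
    simpa using b
  rw [← mk_vec_cen g, hv, hc, h1]

/-- The automorphism attached to data. -/
noncomputable def autOf (hodd : Odd p) {n : ℕ} (d : Data p n) : ES1 p n ≃* ES1 p n :=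
  MulEquiv.ofBijective (homOf hodd d) (homOf_bij hodd d)

theorem autOf_mk (hodd : Odd p) {n : ℕ} (d : Data p n) (x : VV p n) (s : ZMod p) :
    autOf hodd d (mk x s) = mk (d.2.1.1 x) (d.2.2 x + d.1 * s) := homOf_mk hodd d x s

theorem autOf_inj (hodd : Odd p) {n : ℕ} : Function.Injective (autOf hodd (p := p) (n := n)) := by
  rintro ⟨l, ⟨T, hT⟩, f⟩ ⟨l', ⟨T', hT'⟩, f'⟩ h
  have H : ∀ x s, T x = T' x ∧ f x + l * s = f' x + l' * s := by
    intro x s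
    have := DFunLike.congr_fun h (mk x s)
    rw [autOf_mk, autOf_mk] at this
    exact mk_inj this
  have hl : l = l' := by
    apply Units.ext
    simpa using (H 0 1).2
  subst hl
  have hT : T = T' := LinearMap.ext fun x => (H x 0).1
  subst hT
  have hf : f = f' := LinearMap.ext fun x => by simpa using (H x 0).2
  subst hf
  rfl

theorem comm_iff (hodd : Odd p) {n : ℕ} (g h : ES1 p n) :
    g * h = h * g * mk 0 (om p n (vec g) (vec h)) := by
  have h2 := two_ne hodd
  rw [← mk_vec_cen g, ← mk_vec_cen h]
  simp only [mk_mul hodd, vec_mk]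
  rw [skew om_alt (vec h) (vec g)]
  congr 1
  · simp [add_comm]
  · simp
    field_simp
    ring

theorem autOf_surj (hodd : Odd p) {n : ℕ} (hn : 0 < n) :
    Function.Surjective (autOf hodd (p := p) (n := n)) := by
  intro φ
  have h2 := two_ne hodd
  have one_eq : (1 : ES1 p n) = mk 0 0 := by ext <;> simp [mk]
  -- the form represents everything
  have rep : ∀ s : ZMod p, ∃ x y : VV p n, om p n x y = s := fun s =>
    ⟨(Pi.single ⟨0, hn⟩ s, 0), (0, Pi.single ⟨0, hn⟩ 1), by simp [om_apply]⟩
  -- commutators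
  have com : ∀ x y : VV p n, ∀ s t, φ (mk 0 (om p n x y)) =
      mk 0 (om p n (vec (φ (mk x s))) (vec (φ (mk y t)))) := by
    intro x y s t
    have h1 := congrArg φ (comm_iff hodd (mk x s) (mk y t))
    rw [map_mul, map_mul, map_mul, comm_iff hodd (φ _) (φ _)] at h1
    exact (mul_left_cancel h1).symm
  have cent : ∀ s, vec (φ (mk 0 s)) = 0 := by
    intro s
    obtain ⟨x, y, rfl⟩ := rep s
    rw [com x y 0 0, vec_mk]
  let lam : ZMod p →+ ZMod p := AddMonoidHom.mk' (fun s => cen (φ (mk 0 s))) (by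
    intro s t
    have : (mk 0 (s + t) : ES1 p n) = mk 0 s * mk 0 t := by simp [mk_mul hodd]
    rw [this, map_mul, ← mk_vec_cen (φ (mk 0 s)), ← mk_vec_cen (φ (mk 0 t)), cent, cent,
      mk_mul hodd]
    simp)
  have hlam : ∀ s, lam s = lam 1 * s := by
    intro s
    have := (lam.toZModLinearMap p).map_smul s 1
    simpa [mul_comm] using this
  have hφ0 : ∀ s, φ (mk 0 s) = mk 0 (lam 1 * s) := by
    intro s
    rw [← hlam, ← mk_vec_cen (φ (mk 0 s)), cent]
    rfl
  have hl0 : lam 1 ≠ 0 := by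
    intro h
    have h1 := hφ0 1
    rw [h, zero_mul, ← one_eq, map_eq_one_iff φ φ.injective, one_eq] at h1
    exact one_ne_zero (mk_inj h1).2
  have hom1 : ∀ x y, om p n (vec (φ (mk x 0))) (vec (φ (mk y 0))) = lam 1 * om p n x y := by
    intro x y
    have := com x y 0 0
    rw [hφ0] at this
    exact (mk_inj this).2.symm
  have split : ∀ x s, φ (mk x s) =
      mk (vec (φ (mk x 0))) (cen (φ (mk x 0)) + lam 1 * s) := by
    intro x s
    have : (mk x s : ES1 p n) = mk x 0 * mk 0 s := by simp [mk_mul hodd]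
    rw [this, map_mul, hφ0]
    conv_lhs => rw [← mk_vec_cen (φ (mk x 0)), mk_mul hodd]
    simp
  have hadd : ∀ x y, vec (φ (mk (x + y) 0)) = vec (φ (mk x 0)) + vec (φ (mk y 0)) ∧
      cen (φ (mk (x + y) 0)) = cen (φ (mk x 0)) + cen (φ (mk y 0)) := by
    intro x y
    have h1 := congrArg φ (mk_mul hodd x y 0 0)
    rw [map_mul, split (x + y), ← mk_vec_cen (φ (mk x 0)), ← mk_vec_cen (φ (mk y 0)),
      mk_mul hodd, hom1] at h1
    obtain ⟨a, b⟩ := mk_inj h1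
    refine ⟨a.symm, ?_⟩
    linear_combination -b
  let T : VV p n →+ VV p n := AddMonoidHom.mk' (fun x => vec (φ (mk x 0))) fun x y => (hadd x y).1
  let f : VV p n →+ ZMod p := AddMonoidHom.mk' (fun x => cen (φ (mk x 0))) fun x y => (hadd x y).2
  refine ⟨⟨Units.mk0 (lam 1) hl0, ⟨T.toZModLinearMap p, hom1⟩, f.toZModLinearMap p⟩, ?_⟩
  ext1 g
  rw [← mk_vec_cen g, autOf_mk, split]
  rfl

theorem card_dual (n : ℕ) : Nat.card (VV p n →ₗ[ZMod p] ZMod p) = p ^ (2 * n) := by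
  rw [Module.natCard_eq_pow_finrank (K := ZMod p), Nat.card_zmod, Module.finrank_linearMap]
  simp [two_mul]

theorem prod_eq (n : ℕ) :
    ∏ j ∈ Finset.range n, ((p ^ (2 * (j + 1)) - 1) * p ^ (2 * j + 1)) =
      p ^ (n ^ 2) * ∏ j ∈ Finset.Icc 1 n, (p ^ (2 * j) - 1) := by
  induction n with
  | zero => simp
  | succ n ih =>
    rw [Finset.prod_range_succ, ih, Finset.prod_Icc_succ_top (by omega)]
    ring

end ES1Aux

open ES1Aux
theorem ES1_card_aut (p n : ℕ) [Fact p.Prime] (hodd : Odd p) (hn : 0 < n) :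
    Nat.card (ES1 p n ≃* ES1 p n)
      = p ^ (n ^ 2 + 2 * n) * (p - 1) * ∏ j ∈ Finset.Icc 1 n, (p ^ (2 * j) - 1) := by
  rw [← Nat.card_congr (Equiv.ofBijective (autOf hodd (p := p) (n := n))
    ⟨autOf_inj hodd, autOf_surj hodd hn⟩)]
  have : Finite (VV p n →ₗ[ZMod p] VV p n) := Module.finite_of_finite (ZMod p)
  have : Finite (VV p n →ₗ[ZMod p] ZMod p) := Module.finite_of_finite (ZMod p)
  rw [Nat.card_sigma]
  have hs := fun l : (ZMod p)ˣ => card_sim (p := p) (n := n) (l := (l : ZMod p)) l.ne_zero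
  simp_rw [Nat.card_prod, card_dual, hs]
  rw [Finset.sum_const, Finset.card_univ, ZMod.card_units, prod_eq, smul_eq_mul]
  ring
end
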